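/- Conformable fractional Noether theorem under an external force: under the hypotheses of the conformable fractional Noether theorem (L of class C¹; y left α-differentiable with y^(α)_a and p(x) = (∂L/∂v)(x,y,y^(α)_a) left α-differentiable; T, X, G left α-differentiable; y an extremal, i.e. (∂L/∂y) − p^(α)_a = 0; and the necessary invariance condition (∂L/∂x)T + (∂L/∂y)X + (∂L/∂v)[X^(α)_a − y^(α)_a((α−1)T/(x−a) + T^(α)_a/(x−a)^{1−α})] + L·T^(α)_a/(x−a)^{1−α} = G^(α)_a on (a,b)), suppose in addition that f : (a,b) → ℝ is left α-differentiable with (d^α_a f/dx^α)(x) = (1−α)·p(x)·[ X(x)·(x−a)^{1−2α} − y^(α)_a(x)·T(x)/(x−a)^{α} ] + G^(α)_a(x)·(x−a)^{1−α} for all x ∈ (a,b). Then the quantity C(x) = (L(x,y(x),y^(α)_a(x)) − p(x)y^(α)_a(x))·T(x) + p(x)·X(x)·(x−a)^{1−α} − f(x) satisfies (d^α_a C/dx^α)(x) = 0 on (a,b), i.e. C is a conserved quantity (constant). -/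

import Mathlib

open Topology Filter

/-- `f` has left conformable fractional derivative `l` of order `α` starting from `a`,
at the point `x`. -/
def HasConfDerivAt (α a : ℝ) (f : ℝ → ℝ) (l x : ℝ) : Prop :=
  Filter.Tendsto (fun ε : ℝ => (f (x + ε * (x - a) ^ (1 - α)) - f x) / ε)
    (𝓝[≠] (0 : ℝ)) (𝓝 l)

/-- For a base point `x > a`, the conformable derivative is `(x - a) ^ (1 - α)` times the usual
derivative. -/
theorem hasConfDerivAt_iff_hasDerivAt {α a x l : ℝ} {f : ℝ → ℝ} (hx : a < x) :
    HasConfDerivAt α a f l x ↔ HasDerivAt f (l / (x - a) ^ (1 - α)) x := by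
  have hs : (x - a) ^ (1 - α) ≠ 0 := (Real.rpow_pos_of_pos (sub_pos.2 hx) _).ne'
  set s := (x - a) ^ (1 - α)
  have key : HasConfDerivAt α a f l x ↔ HasDerivAt (fun ε : ℝ => f (x + ε * s)) l 0 := by
    rw [hasDerivAt_iff_tendsto_slope_zero]
    refine tendsto_congr fun ε => ?_
    simp [div_eq_inv_mul, s]
  rw [key]
  constructor
  · intro h
    have h0 : HasDerivAt (fun z : ℝ => (z - x) / s) (1 / s) x :=
      ((hasDerivAt_id x).sub_const x).div_const s
    have h' : HasDerivAt (fun ε : ℝ => f (x + ε * s)) l ((x - x) / s) := by simpa using h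
    have hc := h'.comp x h0
    rw [mul_one_div] at hc
    refine hc.congr_of_eventuallyEq (.of_forall fun z => ?_)
    simp [div_mul_cancel₀ _ hs]
  · intro h
    have h0 : HasDerivAt (fun ε : ℝ => x + ε * s) s 0 := by
      simpa using ((hasDerivAt_id (0 : ℝ)).mul_const s).const_add x
    have h' : HasDerivAt f (l / s) (x + 0 * s) := by simpa using h
    simpa [Function.comp_def, div_mul_cancel₀ _ hs] using h'.comp (0 : ℝ) h0

/-- Chain rule for a function of three real variables along a curve `t ↦ (t, u t, v t)`. -/
theorem hasDerivAt_along_graph {L : ℝ → ℝ → ℝ → ℝ} {u v : ℝ → ℝ} {u' v' x : ℝ}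
    (hL : DifferentiableAt ℝ (fun q : ℝ × ℝ × ℝ => L q.1 q.2.1 q.2.2) (x, u x, v x))
    (hu : HasDerivAt u u' x) (hv : HasDerivAt v v' x) :
    HasDerivAt (fun t => L t (u t) (v t))
      (deriv (fun t => L t (u x) (v x)) x + deriv (fun w => L x w (v x)) (u x) * u'
        + deriv (fun w => L x (u x) w) (v x) * v') x := by
  have hF := hL.hasFDerivAt
  set F := fderiv ℝ (fun q : ℝ × ℝ × ℝ => L q.1 q.2.1 q.2.2) (x, u x, v x)
  have h1 : HasDerivAt (fun t => L t (u x) (v x)) (F (1, 0, 0)) x :=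
    hF.comp_hasDerivAt x (f := fun t => (t, u x, v x)) ((hasDerivAt_id x).prodMk
      ((hasDerivAt_const x (u x)).prodMk (hasDerivAt_const x (v x))))
  have h2 : HasDerivAt (fun w => L x w (v x)) (F (0, 1, 0)) (u x) :=
    hF.comp_hasDerivAt (u x) (f := fun w => (x, w, v x)) ((hasDerivAt_const (u x) x).prodMk
      ((hasDerivAt_id (u x)).prodMk (hasDerivAt_const (u x) (v x))))
  have h3 : HasDerivAt (fun w => L x (u x) w) (F (0, 0, 1)) (v x) :=
    hF.comp_hasDerivAt (v x) (f := fun w => (x, u x, w)) ((hasDerivAt_const (v x) x).prodMk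
      ((hasDerivAt_const (v x) (u x)).prodMk (hasDerivAt_id (v x))))
  have h : HasDerivAt (fun t => L t (u t) (v t)) (F (1, u', v')) x :=
    hF.comp_hasDerivAt x (f := fun t => (t, u t, v t))
      ((hasDerivAt_id x).prodMk (hu.prodMk hv))
  rw [h1.deriv, h2.deriv, h3.deriv]
  convert h using 1
  have hdecomp : ((1, u', v') : ℝ × ℝ × ℝ) = (1, 0, 0) + u' • (0, 1, 0) + v' • (0, 0, 1) := by
    simp
  rw [hdecomp, map_add, map_add, map_smul, map_smul, smul_eq_mul, smul_eq_mul]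
  ring

/-- Conformable fractional Noether theorem under the presence of an external force `f`:
under the hypotheses of the conformable Noether theorem, if moreover
`(d^α_a f/dx^α) = (1−α)p[ξ(x−a)^{1−2α} − y^{(α)}_a τ/(x−a)^α] + Λ^{(α)}_a (x−a)^{1−α}`
on `(a,b)`, then
`C = (L − p·y^{(α)}_a)·τ + p·ξ·(x−a)^{1−α} − f`
has vanishing conformable derivative on `(a,b)`, i.e. it is a conserved quantity
(constant on `(a,b)`). Here `T,X,G` denote `τ, ξ, Λ` evaluated along `y`. -/
theorem conformable_noether_external_force
    (α a b : ℝ) (hα0 : 0 < α) (hα1 : α < 1) (hab : a < b)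
    (L : ℝ → ℝ → ℝ → ℝ)
    (hL : ContDiff ℝ 1 (fun q : ℝ × ℝ × ℝ => L q.1 q.2.1 q.2.2))
    (y yα yαα p pα T Tα X Xα G Gα f : ℝ → ℝ)
    (hy : ∀ x ∈ Set.Icc a b, HasConfDerivAt α a y (yα x) x)
    (hyα : ∀ x ∈ Set.Ioo a b, HasConfDerivAt α a yα (yαα x) x)
    (hpdef : ∀ x, p x = deriv (fun v => L x (y x) v) (yα x))
    (hp : ∀ x ∈ Set.Ioo a b, HasConfDerivAt α a p (pα x) x)
    (hT : ∀ x ∈ Set.Ioo a b, HasConfDerivAt α a T (Tα x) x)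
    (hX : ∀ x ∈ Set.Ioo a b, HasConfDerivAt α a X (Xα x) x)
    (hG : ∀ x ∈ Set.Ioo a b, HasConfDerivAt α a G (Gα x) x)
    (hprod1 : ∀ x ∈ Set.Ioo a b, ∃ l,
      HasConfDerivAt α a (fun t => (L t (y t) (yα t) - p t * yα t) * T t) l x)
    (hprod2 : ∀ x ∈ Set.Ioo a b, ∃ l,
      HasConfDerivAt α a (fun t => p t * X t * (t - a) ^ (1 - α)) l x)
    (hEL : ∀ x ∈ Set.Ioo a b, deriv (fun u => L x u (yα x)) (y x) - pα x = 0)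
    (hinv : ∀ x ∈ Set.Ioo a b,
      deriv (fun t => L t (y x) (yα x)) x * T x
        + deriv (fun u => L x u (yα x)) (y x) * X x
        + deriv (fun v => L x (y x) v) (yα x) *
            (Xα x - yα x * ((α - 1) * T x / (x - a) + Tα x / (x - a) ^ (1 - α)))
        + L x (y x) (yα x) * Tα x / (x - a) ^ (1 - α) = Gα x)
    (hf : ∀ x ∈ Set.Ioo a b, HasConfDerivAt α a f
      ((1 - α) * p x * (X x * (x - a) ^ (1 - 2 * α) - yα x * T x / (x - a) ^ α)
        + Gα x * (x - a) ^ (1 - α)) x) :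
    (∀ x ∈ Set.Ioo a b,
      HasConfDerivAt α a
        (fun t => (L t (y t) (yα t) - p t * yα t) * T t
          + p t * X t * (t - a) ^ (1 - α) - f t) 0 x) ∧
    (∀ x₁ ∈ Set.Ioo a b, ∀ x₂ ∈ Set.Ioo a b,
      (L x₁ (y x₁) (yα x₁) - p x₁ * yα x₁) * T x₁
          + p x₁ * X x₁ * (x₁ - a) ^ (1 - α) - f x₁ =
        (L x₂ (y x₂) (yα x₂) - p x₂ * yα x₂) * T x₂
          + p x₂ * X x₂ * (x₂ - a) ^ (1 - α) - f x₂) := by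
  have hC : ∀ x ∈ Set.Ioo a b, HasDerivAt
      (fun t => (L t (y t) (yα t) - p t * yα t) * T t
        + p t * X t * (t - a) ^ (1 - α) - f t) 0 x := by
    intro x hx
    have hax : a < x := hx.1
    have hr : 0 < x - a := sub_pos.2 hax
    have dy := (hasConfDerivAt_iff_hasDerivAt hax).1 (hy x ⟨hx.1.le, hx.2.le⟩)
    have dyα := (hasConfDerivAt_iff_hasDerivAt hax).1 (hyα x hx)
    have dp := (hasConfDerivAt_iff_hasDerivAt hax).1 (hp x hx)
    have dT := (hasConfDerivAt_iff_hasDerivAt hax).1 (hT x hx)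
    have dX := (hasConfDerivAt_iff_hasDerivAt hax).1 (hX x hx)
    have df := (hasConfDerivAt_iff_hasDerivAt hax).1 (hf x hx)
    have dL := hasDerivAt_along_graph (hL.differentiable one_ne_zero _) dy dyα
    have ds : HasDerivAt (fun t : ℝ => (t - a) ^ (1 - α))
        (1 * (1 - α) * (x - a) ^ (1 - α - 1)) x :=
      ((hasDerivAt_id x).sub_const a).rpow_const (Or.inl hr.ne')
    have dC := (((dL.sub (dp.mul dyα)).mul dT).add ((dp.mul dX).mul ds)).sub df
    refine dC.congr_deriv ?_
    have hinvx := hinv x hx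
    have hELx := sub_eq_zero.1 (hEL x hx)
    rw [hELx, ← hpdef x] at hinvx
    simp only [Pi.sub_apply, Pi.mul_apply]
    rw [hELx, ← hpdef x, ← hinvx]
    have e1 : (x - a) ^ α = (x - a) / (x - a) ^ (1 - α) := by
      rw [eq_div_iff (Real.rpow_pos_of_pos hr _).ne', ← Real.rpow_add hr]
      simp
    have e2 : (x - a) ^ (1 - 2 * α) = (x - a) ^ (1 - α) * (x - a) ^ (1 - α) / (x - a) := by
      rw [eq_div_iff hr.ne', ← Real.rpow_add hr, ← Real.rpow_add_one hr.ne']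
      ring_nf
    have e3 : (x - a) ^ (1 - α - 1) = (x - a) ^ (1 - α) / (x - a) :=
      Real.rpow_sub_one hr.ne' _
    rw [e1, e2, e3]
    have hs : (x - a) ^ (1 - α) ≠ 0 := (Real.rpow_pos_of_pos hr _).ne'
    generalize (x - a) ^ (1 - α) = s at hs ⊢
    have hr' := hr.ne'
    generalize x - a = r at hr' ⊢
    field_simp
    ring
  refine ⟨fun x hx => (hasConfDerivAt_iff_hasDerivAt hx.1).2 (by simpa using hC x hx), ?_⟩
  intro x₁ hx₁ x₂ hx₂
  exact isOpen_Ioo.is_const_of_deriv_eq_zero isPreconnected_Ioo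
    (fun x hx => (hC x hx).differentiableAt.differentiableWithinAt)
    (fun x hx => (hC x hx).deriv) hx₁ hx₂
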